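/- arXiv:1802.05395 — 3 statements merged into one kernel-verified Lean document; each statement's English description precedes it below -/
import Mathlib

section
/- Let A be a real M×N matrix, let Σ be a diagonal N×N real matrix with strictly positive diagonal entries Σ_ii, and let σ > 0. Then log det(σI_M + AΣAᵀ) ≤ (M − N)·log σ + Σ_{i=1}^{N} [ log Σ_ii + log( σ·Σ_ii⁻¹ + (AᵀA)_ii ) ]. -/
open Matrix

lemma log_det_le_trace {n : ℕ} (B : Matrix (Fin n) (Fin n) ℝ) (hB : B.PosDef) :
    Real.log B.det ≤ B.trace - n := by
  have h1 := hB.isHermitian.det_eq_prod_eigenvalues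
  have h2 := hB.isHermitian.trace_eq_sum_eigenvalues
  have hp := hB.eigenvalues_pos
  simp only [RCLike.ofReal_real_eq_id, id_eq] at h1 h2
  rw [h1, h2, Real.log_prod (fun i _ => (hp i).ne')]
  calc _ ≤ ∑ i, (hB.isHermitian.eigenvalues i - 1) :=
        Finset.sum_le_sum fun i _ => Real.log_le_sub_one_of_pos (hp i)
    _ = _ := by simp

lemma log_det_le_sum {n : ℕ} (Q : Matrix (Fin n) (Fin n) ℝ) (hQ : Q.PosDef) :
    Real.log Q.det ≤ ∑ i, Real.log (Q i i) := by
  have hd : ∀ i, 0 < Q i i := fun i => hQ.diag_pos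
  let d : Fin n → ℝ := fun i => (Real.sqrt (Q i i))⁻¹
  have hdp : ∀ i, 0 < d i := fun i => inv_pos.2 (Real.sqrt_pos.2 (hd i))
  have hdd : ∀ i, d i * d i = (Q i i)⁻¹ := fun i => by
    simp only [d]; rw [← mul_inv, Real.mul_self_sqrt (hd i).le]
  have hB : (diagonal d * Q * diagonal d).PosDef := by
    have hu : IsUnit (diagonal d) := by
      rw [isUnit_iff_isUnit_det, det_diagonal]
      exact (Finset.prod_pos fun i _ => hdp i).ne'.isUnit
    have := hQ.conjTranspose_mul_mul_same (B := diagonal d) (mulVec_injective_of_isUnit hu)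
    simpa [diagonal_conjTranspose] using this
  have h := log_det_le_trace _ hB
  have ht : (diagonal d * Q * diagonal d).trace = n := by
    have : ∀ i, (diagonal d * Q * diagonal d) i i = 1 := fun i => by
      rw [mul_diagonal, diagonal_mul, mul_right_comm, hdd, inv_mul_cancel₀ (hd i).ne']
    simp [trace, this]
  have hdet : (diagonal d * Q * diagonal d).det = Q.det * ∏ i, (Q i i)⁻¹ := by
    simp_rw [← hdd]
    rw [det_mul, det_mul, det_diagonal, Finset.prod_mul_distrib]; ring
  rw [ht, hdet, Real.log_mul hQ.det_pos.ne'
    (Finset.prod_pos fun i _ => inv_pos.2 (hd i)).ne',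
    Real.log_prod (fun i _ => (inv_pos.2 (hd i)).ne')] at h
  simp only [Real.log_inv, Finset.sum_neg_distrib] at h
  linarith

/-- Log-determinant upper bound (Hadamard-type): for `Σ` diagonal with positive diagonal
entries and `σ > 0`,
`log det(σI_M + AΣAᵀ) ≤ (M - N) log σ + Σᵢ [log Σᵢᵢ + log(σ Σᵢᵢ⁻¹ + (AᵀA)ᵢᵢ)]`. -/
theorem stmt_5 {M N : ℕ} (A : Matrix (Fin M) (Fin N) ℝ) (S : Matrix (Fin N) (Fin N) ℝ)
    (hdiag : ∀ i j, i ≠ j → S i j = 0) (hpos : ∀ i, 0 < S i i)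
    (σ : ℝ) (hσ : 0 < σ) :
    Real.log ((σ • (1 : Matrix (Fin M) (Fin M) ℝ) + A * S * Aᵀ).det) ≤
      ((M : ℝ) - (N : ℝ)) * Real.log σ +
        ∑ i : Fin N, (Real.log (S i i) + Real.log (σ * (S i i)⁻¹ + (Aᵀ * A) i i)) := by
  have hS : S = diagonal (fun i => S i i) := by
    ext i j
    by_cases h : i = j
    · subst h; simp
    · rw [hdiag i j h, diagonal_apply_ne _ h]
  generalize hs : (fun i => S i i) = s at hS
  have hsi : ∀ i, S i i = s i := fun i => congrFun hs i
  simp only [hsi] at hpos ⊢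
  subst hS
  clear hs hsi hdiag
  let Q : Matrix (Fin N) (Fin N) ℝ := diagonal (fun i => σ * (s i)⁻¹) + Aᵀ * A
  have hQ : Q.PosDef := by
    refine PosDef.add_posSemidef (PosDef.diagonal fun i => mul_pos hσ (inv_pos.2 (hpos i))) ?_
    simpa using posSemidef_conjTranspose_mul_self A
  have hQd : ∀ i, Q i i = σ * (s i)⁻¹ + (Aᵀ * A) i i := fun i => by simp [Q]
  have hdet : (σ • (1 : Matrix (Fin M) (Fin M) ℝ) + A * diagonal s * Aᵀ).det
      = σ ^ M * (Q.det * ∏ i, (σ⁻¹ * s i)) := by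
    have e1 : σ • (1 : Matrix (Fin M) (Fin M) ℝ) + A * diagonal s * Aᵀ
        = σ • (1 + (A * diagonal (fun i => σ⁻¹ * s i)) * Aᵀ) := by
      have : diagonal (fun i => σ⁻¹ * s i) = σ⁻¹ • diagonal s := by
        rw [← diagonal_smul]; rfl
      rw [this, smul_add, Matrix.mul_smul, Matrix.smul_mul, smul_smul, mul_inv_cancel₀ hσ.ne',
        one_smul]
    have e2 : 1 + Aᵀ * (A * diagonal (fun i => σ⁻¹ * s i))
        = Q * diagonal (fun i => σ⁻¹ * s i) := by
      simp only [Q]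
      rw [Matrix.add_mul, diagonal_mul_diagonal, Matrix.mul_assoc, ← diagonal_one]
      congr 2
      ext i
      have := (hpos i).ne'
      field_simp
    rw [e1, det_smul, det_one_add_mul_comm, e2, det_mul, det_diagonal, Fintype.card_fin]
  have hp : ∀ i, 0 < σ⁻¹ * s i := fun i => mul_pos (inv_pos.2 hσ) (hpos i)
  have h := log_det_le_sum Q hQ
  have hpp := (Finset.prod_pos fun i (_ : i ∈ Finset.univ) => hp i).ne'
  rw [hdet, Real.log_mul (pow_pos hσ M).ne' (mul_ne_zero hQ.det_pos.ne' hpp),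
    Real.log_mul hQ.det_pos.ne' hpp, Real.log_prod (fun i _ => (hp i).ne'), Real.log_pow]
  simp only [hQd] at h
  have h3 : ∑ i, Real.log (σ⁻¹ * s i) = -(N * Real.log σ) + ∑ i, Real.log (s i) := by
    simp_rw [fun i => Real.log_mul (inv_pos.2 hσ).ne' (hpos i).ne', Real.log_inv]
    simp [Finset.sum_add_distrib]
  rw [h3, Finset.sum_add_distrib]
  linarith
end

section
/- Let B be a symmetric positive semidefinite M×M real matrix, and let λ, λ⁰ ∈ ℝ^M have all entries strictly positive. With η_k = [(diag(λ⁰) + B)⁻¹]_{kk}, it holds that log det(diag(λ) + B) ≤ log det(diag(λ⁰) + B) + Σ_{k=1}^{M} η_k (λ_k − λ⁰_k). -/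
open Matrix

theorem aux_logdet {M : ℕ} (P : Matrix (Fin M) (Fin M) ℝ) (hP : P.PosDef) :
    Real.log P.det ≤ P.trace - M := by
  rw [hP.isHermitian.det_eq_prod_eigenvalues, hP.isHermitian.trace_eq_sum_eigenvalues]
  simp only [RCLike.ofReal_real_eq_id, id_eq]
  rw [Real.log_prod (fun i _ => (hP.eigenvalues_pos i).ne')]
  calc _ ≤ ∑ i, (hP.isHermitian.eigenvalues i - 1) :=
        Finset.sum_le_sum fun i _ => Real.log_le_sub_one_of_pos (hP.eigenvalues_pos i)
    _ = _ := by simp [Finset.sum_sub_distrib]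

/-- First-order (tangent/conjugate) upper bound for the concave function
`h(λ) = log det(diag(λ) + B)`: with `η_k = [(diag(λ⁰) + B)⁻¹]_{kk}`,
`h(λ) ≤ h(λ⁰) + Σ_k η_k (λ_k - λ⁰_k)` for all `λ, λ⁰` in the positive orthant. -/
theorem stmt_10 {M : ℕ} (B : Matrix (Fin M) (Fin M) ℝ) (hB : B.PosSemidef)
    (l l0 : Fin M → ℝ) (hl : ∀ k, 0 < l k) (hl0 : ∀ k, 0 < l0 k) :
    Real.log ((Matrix.diagonal l + B).det) ≤
      Real.log ((Matrix.diagonal l0 + B).det) +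
        ∑ k : Fin M, ((Matrix.diagonal l0 + B)⁻¹ k k) * (l k - l0 k) := by
  have hA : (Matrix.diagonal l + B).PosDef := (Matrix.PosDef.diagonal hl).add_posSemidef hB
  have hA0 : (Matrix.diagonal l0 + B).PosDef := (Matrix.PosDef.diagonal hl0).add_posSemidef hB
  have hsub : Matrix.diagonal l + B = (Matrix.diagonal l0 + B) + Matrix.diagonal (fun k => l k - l0 k) := by
    ext i j
    by_cases h : i = j
    · subst h; simp; ring
    · simp [h]
  generalize Matrix.diagonal l + B = A at *
  generalize Matrix.diagonal l0 + B = A0 at *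
  obtain ⟨C, hC⟩ : ∃ C : Matrix (Fin M) (Fin M) ℝ, A0⁻¹ = Cᴴ * C := by
    open scoped MatrixOrder in
    obtain ⟨C, hC⟩ := CStarAlgebra.nonneg_iff_eq_star_mul_self.mp hA0.inv.posSemidef.nonneg
    exact ⟨C, hC⟩
  have hd0 := hA0.det_pos
  have hd := hA.det_pos
  have hdet : A0⁻¹.det = Cᴴ.det * C.det := by rw [hC, det_mul]
  have hi : 0 < A0⁻¹.det := hA0.inv.det_pos
  have hu : IsUnit C := by
    rw [Matrix.isUnit_iff_isUnit_det, isUnit_iff_ne_zero]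
    intro h
    rw [h, mul_zero] at hdet
    exact hi.ne' hdet
  have hP : (C * A * Cᴴ).PosDef :=
    hA.mul_mul_conjTranspose_same (Matrix.vecMul_injective_of_isUnit hu)
  have key := aux_logdet _ hP
  have e1 : (C * A * Cᴴ).det = A0.det⁻¹ * A.det := by
    rw [det_mul, det_mul]
    rw [det_nonsing_inv, Ring.inverse_eq_inv'] at hdet
    rw [hdet]; ring
  have e2 : (C * A * Cᴴ).trace = M + ∑ k : Fin M, (A0⁻¹ k k) * (l k - l0 k) := by
    rw [trace_mul_comm, ← mul_assoc, ← hC, hsub, mul_add,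
      nonsing_inv_mul _ (isUnit_iff_ne_zero.mpr hd0.ne'), trace_add]
    simp [Matrix.trace, Matrix.mul_diagonal]
  rw [e1, e2, Real.log_mul (inv_ne_zero hd0.ne') hd.ne', Real.log_inv] at key
  linarith
end

section
/- Let A be a real M×N matrix, let Σ be a symmetric positive definite N×N real matrix, let σ > 0, and let y ∈ ℝ^M. Define L(x) = (1/(2σ))(y − Ax)ᵀ(y − Ax) + (1/2)xᵀΣ⁻¹x + (1/2)·log det(σI_M + AΣAᵀ). Then the infimum of L over x ∈ ℝ^N equals (1/2)·yᵀ(σI_M + AΣAᵀ)⁻¹y + (1/2)·log det(σI_M + AΣAᵀ), i.e., minimizing the paper's joint cost over the latent sparse signal recovers the marginal-likelihood cost exactly. -/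
open Matrix

theorem key_identity {M N : ℕ} (A : Matrix (Fin M) (Fin N) ℝ) (S : Matrix (Fin N) (Fin N) ℝ)
    (hS : S.PosDef) (σ : ℝ) (hσ : 0 < σ) (y z : Fin M → ℝ)
    (hz : y = σ • z + A *ᵥ (S *ᵥ (Aᵀ *ᵥ z))) (d : Fin N → ℝ) :
    (1 / (2 * σ)) * ((y - A *ᵥ (S *ᵥ (Aᵀ *ᵥ z) + d)) ⬝ᵥ (y - A *ᵥ (S *ᵥ (Aᵀ *ᵥ z) + d)))
      + (1 / 2) * ((S *ᵥ (Aᵀ *ᵥ z) + d) ⬝ᵥ S⁻¹ *ᵥ (S *ᵥ (Aᵀ *ᵥ z) + d))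
    = (1 / 2) * (y ⬝ᵥ z) + ((1 / (2 * σ)) * ((A *ᵥ d) ⬝ᵥ (A *ᵥ d))
      + (1 / 2) * (d ⬝ᵥ S⁻¹ *ᵥ d)) := by
  have hdet : IsUnit S.det := (Matrix.isUnit_iff_isUnit_det S).1 hS.isUnit
  have hT : S⁻¹ᵀ = S⁻¹ := by
    have := hS.inv.isHermitian
    simpa [Matrix.IsHermitian, conjTranspose_eq_transpose_of_trivial] using this
  have h1 : y - A *ᵥ (S *ᵥ (Aᵀ *ᵥ z) + d) = σ • z - A *ᵥ d := by
    rw [hz, mulVec_add]; abel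
  have h2 : S⁻¹ *ᵥ (S *ᵥ (Aᵀ *ᵥ z)) = Aᵀ *ᵥ z := by
    rw [mulVec_mulVec, nonsing_inv_mul _ hdet, one_mulVec]
  have h3 : ∀ v : Fin N → ℝ, v ⬝ᵥ (Aᵀ *ᵥ z) = (A *ᵥ v) ⬝ᵥ z := by
    intro v
    rw [dotProduct_mulVec, vecMul_transpose]
  have h4 : (S *ᵥ (Aᵀ *ᵥ z)) ⬝ᵥ S⁻¹ *ᵥ d = (A *ᵥ d) ⬝ᵥ z := by
    rw [dotProduct_mulVec, ← mulVec_transpose, hT, h2, dotProduct_comm, h3]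
  have h5 : y ⬝ᵥ z = σ * (z ⬝ᵥ z) + (A *ᵥ (S *ᵥ (Aᵀ *ᵥ z))) ⬝ᵥ z := by
    conv_lhs => rw [hz]
    rw [add_dotProduct, smul_dotProduct, smul_eq_mul]
  rw [h1, h5, mulVec_add, h2, add_dotProduct, dotProduct_add, dotProduct_add, h4, h3, h3]
  simp only [sub_dotProduct, dotProduct_sub, smul_dotProduct, dotProduct_smul, smul_eq_mul]
  rw [dotProduct_comm z (A *ᵥ d)]
  field_simp
  ring

/-- Minimizing the joint cost `L` of Eq. (13) over the latent sparse signal recovers the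
marginal-likelihood cost: the infimum over `x` of
`(1/(2σ))(y-Ax)ᵀ(y-Ax) + (1/2)xᵀΣ⁻¹x + (1/2)log det(σI + AΣAᵀ)` equals
`(1/2) yᵀ(σI + AΣAᵀ)⁻¹y + (1/2) log det(σI + AΣAᵀ)`. -/
theorem stmt_15 {M N : ℕ} (A : Matrix (Fin M) (Fin N) ℝ) (S : Matrix (Fin N) (Fin N) ℝ)
    (hS : S.PosDef) (σ : ℝ) (hσ : 0 < σ) (y : Fin M → ℝ) :
    (⨅ x : Fin N → ℝ,
        ((1 / (2 * σ)) * ((y - A.mulVec x) ⬝ᵥ (y - A.mulVec x))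
          + (1 / 2) * (x ⬝ᵥ S⁻¹.mulVec x)
          + (1 / 2) * Real.log ((σ • (1 : Matrix (Fin M) (Fin M) ℝ) + A * S * Aᵀ).det))) =
      (1 / 2) * (y ⬝ᵥ (σ • (1 : Matrix (Fin M) (Fin M) ℝ) + A * S * Aᵀ)⁻¹.mulVec y)
        + (1 / 2) * Real.log ((σ • (1 : Matrix (Fin M) (Fin M) ℝ) + A * S * Aᵀ).det) := by
  have hK : (σ • (1 : Matrix (Fin M) (Fin M) ℝ) + A * S * Aᵀ).PosDef := by
    refine Matrix.PosDef.add_posSemidef (Matrix.PosDef.one.smul hσ) ?_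
    simpa [conjTranspose_eq_transpose_of_trivial] using
      hS.posSemidef.mul_mul_conjTranspose_same A
  have hdet := (Matrix.isUnit_iff_isUnit_det _).1 hK.isUnit
  generalize Real.log _ = c
  set z := (σ • (1 : Matrix (Fin M) (Fin M) ℝ) + A * S * Aᵀ)⁻¹ *ᵥ y with hzdef
  have hz : y = σ • z + A *ᵥ (S *ᵥ (Aᵀ *ᵥ z)) := by
    have : (σ • (1 : Matrix (Fin M) (Fin M) ℝ) + A * S * Aᵀ) *ᵥ z = y := by
      rw [hzdef, mulVec_mulVec, mul_nonsing_inv _ hdet, one_mulVec]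
    rw [add_mulVec, smul_mulVec, one_mulVec, ← mulVec_mulVec, ← mulVec_mulVec] at this
    exact this.symm
  have key := key_identity A S hS σ hσ y z hz
  have lb : ∀ x : Fin N → ℝ, (1 / 2) * (y ⬝ᵥ z) + (1 / 2) * c ≤
      (1 / (2 * σ)) * ((y - A.mulVec x) ⬝ᵥ (y - A.mulVec x))
          + (1 / 2) * (x ⬝ᵥ S⁻¹.mulVec x) + (1 / 2) * c := by
    intro x
    have h := key (x - S *ᵥ (Aᵀ *ᵥ z))
    rw [add_sub_cancel] at h
    rw [h]
    have a1 : 0 ≤ (A *ᵥ (x - S *ᵥ (Aᵀ *ᵥ z))) ⬝ᵥ (A *ᵥ (x - S *ᵥ (Aᵀ *ᵥ z))) :=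
      Finset.sum_nonneg fun i _ => mul_self_nonneg _
    have a2 := hS.inv.posSemidef.dotProduct_mulVec_nonneg (x - S *ᵥ (Aᵀ *ᵥ z))
    rw [star_trivial] at a2
    have a3 := mul_nonneg (by positivity : (0 : ℝ) ≤ 1 / (2 * σ)) a1
    linarith
  apply le_antisymm
  · refine (ciInf_le ⟨_, Set.forall_mem_range.2 lb⟩ (S *ᵥ (Aᵀ *ᵥ z))).trans ?_
    have h := key 0
    simp only [add_zero, mulVec_zero, dotProduct_zero, mul_zero] at h
    rw [h]
  · exact le_ciInf lb
end
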